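/- Let ρ and Ω ≥ 2 be positive integers, t = 3ρ, and let α_1, …, α_t be positive integers with Ω/4 < α_i < Ω/2 for every i and Σ_i α_i = ρ·Ω. Let G be the disjoint union of cliques C_1, …, C_t of sizes α_1, …, α_t. Then there exists a partition of the vertex set of G into ρ blocks each of size Ω with OR(G) = (Σ_i α_i(α_i − 1)) / (ρ·Ω·(Ω − 1)) if and only if the index set {1, …, t} can be partitioned into ρ triples such that the α-sum of each triple equals Ω. -/

import Mathlib

open Finset

variable {V : Type*}

/-- The overlap ratio `OR(u)` of a vertex `u` for the block layout `blk`. -/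
noncomputable def ORv [Fintype V] [DecidableEq V] (G : SimpleGraph V) [DecidableRel G.Adj]
    (blk : V → Finset V) (u : V) : ℝ :=
  if 1 < (blk u).card then
    ((blk u ∩ G.neighborFinset u).card : ℝ) / (((blk u).card : ℝ) - 1)
  else 0

/-- The overlap ratio `OR(G) = (1/|V|) ∑_{u ∈ V} OR(u)` of the layout `blk`. -/
noncomputable def ORG [Fintype V] [DecidableEq V] (G : SimpleGraph V) [DecidableRel G.Adj]
    (blk : V → Finset V) : ℝ :=
  (∑ u : V, ORv G blk u) / (Fintype.card V : ℝ)

/-- A layout whose blocks all have size `k` attains the overlap ratio given by the degree sum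
exactly when every neighborhood lies inside the block of its vertex. -/
lemma ORG_eq_degree_sum_iff [Fintype V] [DecidableEq V] [Nonempty V]
    (G : SimpleGraph V) [DecidableRel G.Adj] (blk : V → Finset V) {k : ℕ} (hk : 2 ≤ k)
    (hblk : ∀ u, (blk u).card = k) :
    ORG G blk = (∑ u, (G.degree u : ℝ)) / ((Fintype.card V : ℝ) * ((k : ℝ) - 1)) ↔
      ∀ u, G.neighborFinset u ⊆ blk u := by
  have hk' : (k : ℝ) - 1 ≠ 0 := by
    have : (2 : ℝ) ≤ k := by exact_mod_cast hk
    linarith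
  have hV : (Fintype.card V : ℝ) ≠ 0 := by exact_mod_cast Fintype.card_ne_zero
  have hOR : ORG G blk = (∑ u, ((blk u ∩ G.neighborFinset u).card : ℝ)) /
      ((Fintype.card V : ℝ) * ((k : ℝ) - 1)) := by
    have h1 : 1 < k := hk
    simp only [ORG, ORv, hblk, if_pos h1]
    rw [← Finset.sum_div, div_div, mul_comm]
  rw [hOR, div_left_inj' (mul_ne_zero hV hk')]
  have hle : ∀ u ∈ (univ : Finset V), (blk u ∩ G.neighborFinset u).card ≤ G.degree u :=
    fun u _ => card_le_card inter_subset_right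
  rw [← Nat.cast_sum, ← Nat.cast_sum, Nat.cast_inj, Finset.sum_eq_sum_iff_of_le hle]
  refine forall_congr' fun u => ?_
  simp only [mem_univ, true_imp_iff]
  constructor
  · intro h
    exact inter_eq_right.1 (eq_of_subset_of_card_le inter_subset_right h.ge)
  · intro h
    rw [inter_eq_right.2 h, SimpleGraph.card_neighborFinset_eq_degree]

/-- In a partition into blocks of equal size, the number of blocks times that size is the
number of vertices. -/
lemma card_image_block_mul [Fintype V] [DecidableEq V] (blk : V → Finset V) {k : ℕ}
    (hmem : ∀ v, v ∈ blk v) (heq : ∀ u v : V, v ∈ blk u → blk v = blk u)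
    (hblk : ∀ u, (blk u).card = k) :
    (univ.image blk).card * k = Fintype.card V := by
  have h := Finset.card_eq_sum_card_image blk (univ : Finset V)
  rw [card_univ] at h
  rw [h, Finset.sum_const_nat]
  intro b hb
  obtain ⟨u, -, rfl⟩ := mem_image.1 hb
  rw [← hblk u]
  congr 1
  ext v
  simp only [mem_filter, mem_univ, true_and]
  exact ⟨fun h => h ▸ hmem v, heq u v⟩

/-- The number of vertices with label in `p` is the sum of the label class sizes. -/
lemma card_filter_mem_eq_sum [Fintype V] {ι : Type*} [DecidableEq ι] {c : V → ι} {α : ι → ℕ}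
    (hα : ∀ i, (univ.filter fun v => c v = i).card = α i) (p : Finset ι) :
    (univ.filter fun v => c v ∈ p).card = ∑ i ∈ p, α i := by
  rw [Finset.card_eq_sum_card_fiberwise (f := c) (t := p) (fun v hv => by simpa using hv)]
  refine sum_congr rfl fun i hi => ?_
  rw [← hα i, filter_filter]
  congr 1
  ext v
  simp only [mem_filter, mem_univ, true_and, and_iff_right_iff_imp]
  rintro rfl
  exact hi

/-- Numbers strictly between `m / 4` and `m / 2` that sum to `m` are three in number. -/
lemma card_eq_three_of_sum_eq {ι : Type*} {α : ι → ℕ} {m : ℕ} (hm : 0 < m)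
    (hlb : ∀ i, m < 4 * α i) (hub : ∀ i, 2 * α i < m) {p : Finset ι}
    (hp : ∑ i ∈ p, α i = m) : p.card = 3 := by
  have hne : p.Nonempty := by
    rw [nonempty_iff_ne_empty]
    rintro rfl
    simp at hp
    omega
  have h1 : ∑ _i ∈ p, m < ∑ i ∈ p, 4 * α i := sum_lt_sum_of_nonempty hne fun i _ => hlb i
  have h2 : ∑ i ∈ p, 2 * α i < ∑ _i ∈ p, m := sum_lt_sum_of_nonempty hne fun i _ => hub i
  rw [← mul_sum, hp, sum_const, smul_eq_mul] at h1 h2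
  have := lt_of_mul_lt_mul_right h1 hm.le
  have := lt_of_mul_lt_mul_right h2 hm.le
  omega

/-- **combinatorial core of the reduction in Theorem 4.1.**
Let `ρ` and `Ω ≥ 2` be positive integers, `t = 3ρ`, and `α : Fin (3ρ) → ℕ` positive
integers with `Ω/4 < α i < Ω/2` and `∑ i, α i = ρ·Ω`.  Let `G` be the disjoint union of
cliques of sizes `α i` (the cliques being the fibers of `c : V → Fin (3ρ)`).  Then there
is a partition of the vertex set into `ρ` blocks, each of size `Ω`, whose overlap ratio
attains `(∑ i, α_i (α_i − 1)) / (ρ·Ω·(Ω − 1))`, iff the index set can be partitioned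
into `ρ` triples whose `α`-sums each equal `Ω`. -/
theorem optimal_layout_iff_triple_partition
    [Fintype V] [DecidableEq V]
    (ρ Ω : ℕ) (hρ : 0 < ρ) (hΩ : 2 ≤ Ω)
    (α : Fin (3 * ρ) → ℕ) (hpos : ∀ i, 0 < α i)
    (hlb : ∀ i, Ω < 4 * α i) (hub : ∀ i, 2 * α i < Ω)
    (hsum : ∑ i, α i = ρ * Ω)
    (G : SimpleGraph V) [DecidableRel G.Adj] (c : V → Fin (3 * ρ))
    (hG : ∀ u v : V, G.Adj u v ↔ u ≠ v ∧ c u = c v)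
    (hα : ∀ i, (Finset.univ.filter fun v => c v = i).card = α i) :
    (∃ blk : V → Finset V,
      (∀ v, v ∈ blk v) ∧ (∀ u v : V, v ∈ blk u → blk v = blk u) ∧
      (Finset.univ.image blk).card = ρ ∧ (∀ u, (blk u).card = Ω) ∧
      ORG G blk =
        (∑ i, (α i : ℝ) * ((α i : ℝ) - 1)) / ((ρ : ℝ) * (Ω : ℝ) * ((Ω : ℝ) - 1))) ↔
    (∃ P : Finset (Finset (Fin (3 * ρ))),
      (∀ p ∈ P, ∀ q ∈ P, p ≠ q → Disjoint p q) ∧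
      P.biUnion id = Finset.univ ∧ P.card = ρ ∧
      ∀ p ∈ P, p.card = 3 ∧ ∑ i ∈ p, α i = Ω) := by
  classical
  have hcard : Fintype.card V = ρ * Ω := by
    rw [← hsum, ← card_filter_mem_eq_sum hα univ]
    simp
  have hcardpos : 0 < Fintype.card V := by rw [hcard]; positivity
  have : Nonempty V := Fintype.card_pos_iff.1 hcardpos
  have hdeg : ∀ u, (G.degree u : ℝ) = (α (c u) : ℝ) - 1 := by
    intro u
    have hN : G.neighborFinset u = (univ.filter fun v => c v = c u).erase u := by
      ext v
      simp only [SimpleGraph.mem_neighborFinset, hG, mem_erase, mem_filter, mem_univ, true_and]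
      exact ⟨fun h => ⟨h.1.symm, h.2.symm⟩, fun h => ⟨h.1.symm, h.2.symm⟩⟩
    rw [← SimpleGraph.card_neighborFinset_eq_degree, hN, card_erase_of_mem (by simp), hα,
      Nat.cast_sub (hpos _), Nat.cast_one]
  have hdegsum : ∑ u, (G.degree u : ℝ) = ∑ i, (α i : ℝ) * ((α i : ℝ) - 1) := by
    rw [← sum_fiberwise univ c]
    refine sum_congr rfl fun i _ => ?_
    rw [sum_congr rfl (g := fun _ => (α i : ℝ) - 1), sum_const, hα, nsmul_eq_mul]
    intro u hu
    rw [hdeg, (mem_filter.1 hu).2]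
  have hiff : ∀ blk : V → Finset V, (∀ v, v ∈ blk v) → (∀ u, (blk u).card = Ω) →
      (ORG G blk =
        (∑ i, (α i : ℝ) * ((α i : ℝ) - 1)) / ((ρ : ℝ) * (Ω : ℝ) * ((Ω : ℝ) - 1)) ↔
      ∀ u v, c u = c v → v ∈ blk u) := by
    intro blk hmem hblk
    have h := ORG_eq_degree_sum_iff G blk hΩ hblk
    rw [hdegsum, hcard, Nat.cast_mul] at h
    rw [h]
    refine forall_congr' fun u => forall_congr' fun v => ?_
    rw [SimpleGraph.mem_neighborFinset, hG]
    constructor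
    · intro h huv
      by_cases e : u = v
      · exact e ▸ hmem u
      · exact h ⟨e, huv⟩
    · exact fun h huv => h huv.2
  constructor
  · rintro ⟨blk, hmem, heq, -, hblk, hOR⟩
    rw [hiff blk hmem hblk] at hOR
    have hdisj : ∀ p ∈ univ.image (fun u => (blk u).image c),
        ∀ q ∈ univ.image (fun u => (blk u).image c), p ≠ q → Disjoint p q := by
      intro p hp q hq hpq
      obtain ⟨u, -, rfl⟩ := mem_image.1 hp
      obtain ⟨v, -, rfl⟩ := mem_image.1 hq
      rw [disjoint_left]
      intro i hi hj
      obtain ⟨a, ha, rfl⟩ := mem_image.1 hi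
      obtain ⟨b, hb, hab⟩ := mem_image.1 hj
      refine hpq ?_
      have : blk u = blk v := by
        rw [← heq u a ha, ← heq v b hb, heq a b (hOR a b hab.symm)]
      simp only [this]
    have hunion : (univ.image (fun u => (blk u).image c)).biUnion id = univ := by
      refine eq_univ_iff_forall.2 fun i => ?_
      have hi : 0 < (univ.filter fun v => c v = i).card := by rw [hα]; exact hpos i
      obtain ⟨v, hv⟩ := card_pos.1 hi
      rw [← (mem_filter.1 hv).2]
      exact mem_biUnion.2 ⟨_, mem_image_of_mem _ (mem_univ v), mem_image_of_mem c (hmem v)⟩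
    have htriple : ∀ p ∈ univ.image (fun u => (blk u).image c),
        p.card = 3 ∧ ∑ i ∈ p, α i = Ω := by
      intro p hp
      obtain ⟨u, -, rfl⟩ := mem_image.1 hp
      have hs : ∑ i ∈ (blk u).image c, α i = Ω := by
        rw [← card_filter_mem_eq_sum hα, ← hblk u]
        congr 1
        ext v
        simp only [mem_filter, mem_univ, true_and]
        refine ⟨fun hv => ?_, mem_image_of_mem c⟩
        obtain ⟨a, ha, hav⟩ := mem_image.1 hv
        exact heq u a ha ▸ hOR a v hav
      exact ⟨card_eq_three_of_sum_eq (by omega) hlb hub hs, hs⟩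
    refine ⟨_, hdisj, hunion, ?_, htriple⟩
    have h := card_biUnion (t := id) hdisj
    rw [hunion, card_univ, Fintype.card_fin,
      sum_const_nat (f := fun p => (id p).card) fun p hp => (htriple p hp).1] at h
    omega
  · rintro ⟨P, hdisj, hunion, -, hP⟩
    have hex : ∀ i, ∃ p ∈ P, i ∈ p := by
      intro i
      simpa using hunion.ge (mem_univ i)
    choose p hpP hip using hex
    have hpeq : ∀ i j, j ∈ p i → p j = p i := by
      intro i j hj
      by_contra hne
      exact disjoint_left.1 (hdisj _ (hpP j) _ (hpP i) hne) (hip j) hj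
    have hmem : ∀ v, v ∈ univ.filter fun w => c w ∈ p (c v) := fun v => by simp [hip]
    have heq : ∀ u v : V, (v ∈ univ.filter fun w => c w ∈ p (c u)) →
        (univ.filter fun w => c w ∈ p (c v)) = univ.filter fun w => c w ∈ p (c u) := by
      intro u v hv
      rw [hpeq _ _ (mem_filter.1 hv).2]
    have hblk : ∀ u : V, (univ.filter fun w => c w ∈ p (c u)).card = Ω := by
      intro u
      rw [card_filter_mem_eq_sum hα, (hP _ (hpP _)).2]
    refine ⟨fun v => univ.filter fun w => c w ∈ p (c v), hmem, heq, ?_, hblk, ?_⟩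
    · have h := card_image_block_mul _ hmem heq hblk
      rw [hcard] at h
      exact Nat.eq_of_mul_eq_mul_right (by omega) h
    · rw [hiff _ hmem hblk]
      intro u v huv
      simp [huv, hip]
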